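/- arXiv:1908.06713 — 6 statements merged into one kernel-verified Lean document; each statement's English description precedes it below -/
import Mathlib

section
/- Let n ≥ 2, let T ∈ M_{n-1}(ℂ), u ∈ ℂ^{n-1} (a column vector) and λ ∈ ℂ, and let T' ∈ M_n(ℂ) be the block upper-triangular matrix T' = [[T, u],[0, λ]]. Then det(I_n + T' T'^*) = (1 + |λ|²) · det(I_{n-1} + T T^*) · (1 + (1/(1+|λ|²)) · u^* (I_{n-1} + T T^*)^{-1} u). -/
open Matrix

/-- Recursive decomposition of `det (I + T' T'^*)` for a block upper-triangular
matrix `T' = [[T, u], [0, λ]]` (spherical ensemble case). -/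
theorem det_one_add_blockTriangular_mul_conjTranspose
    (n : ℕ) (hn : 1 ≤ n) (T : Matrix (Fin n) (Fin n) ℂ) (u : Fin n → ℂ) (l : ℂ)
    (T' : Matrix (Fin n ⊕ Fin 1) (Fin n ⊕ Fin 1) ℂ)
    (hT' : T' = Matrix.fromBlocks T (Matrix.of fun i (_ : Fin 1) => u i) 0
      (Matrix.of fun (_ : Fin 1) (_ : Fin 1) => l)) :
    Matrix.det (1 + T' * T'ᴴ)
      = ((1 + ‖l‖ ^ 2 : ℝ) : ℂ) * Matrix.det (1 + T * Tᴴ)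
        * (1 + (((1 + ‖l‖ ^ 2 : ℝ) : ℂ))⁻¹ * (star u ⬝ᵥ ((1 + T * Tᴴ)⁻¹ *ᵥ u))) := by
  have hA : IsUnit (1 + T * Tᴴ).det := by
    open scoped ComplexOrder in
    have h : (1 + T * Tᴴ).PosDef :=
      Matrix.PosDef.one.add_posSemidef (Matrix.posSemidef_self_mul_conjTranspose T)
    exact (Matrix.isUnit_iff_isUnit_det _).1 h.isUnit
  have hc : ((1 + ‖l‖ ^ 2 : ℝ) : ℂ) ≠ 0 := by
    have : (1 + ‖l‖ ^ 2 : ℝ) ≠ 0 := by positivity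
    exact_mod_cast this
  have hcl : ((1 + ‖l‖ ^ 2 : ℝ) : ℂ) = 1 + l * star l := by
    have := Complex.mul_conj' l
    push_cast
    rw [← this]; rfl
  generalize ((1 + ‖l‖ ^ 2 : ℝ) : ℂ) = c at hc hcl ⊢
  generalize hAd : 1 + T * Tᴴ = A at hA ⊢
  let D : Matrix (Fin 1) (Fin 1) ℂ := Matrix.of fun _ _ => c
  let D' : Matrix (Fin 1) (Fin 1) ℂ := Matrix.of fun _ _ => c⁻¹
  letI : Invertible D := ⟨D', by
    ext i j; fin_cases i; fin_cases j; simp [D, D', Matrix.mul_apply, hc], by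
    ext i j; fin_cases i; fin_cases j; simp [D, D', Matrix.mul_apply, hc]⟩
  have hinv : ⅟D = D' := rfl
  have hblock : 1 + T' * T'ᴴ = Matrix.fromBlocks
      (A + Matrix.of fun i j => u i * star (u j))
      (Matrix.of fun i _ => u i * star l) (Matrix.of fun _ j => l * star (u j)) D := by
    rw [hT', Matrix.fromBlocks_conjTranspose, Matrix.fromBlocks_multiply,
      ← Matrix.fromBlocks_one, Matrix.fromBlocks_add, ← hAd]
    congr 1
    · rw [add_assoc]; congr 2
      ext i j; simp [Matrix.mul_apply]
    · ext i j; simp [Matrix.mul_apply]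
    · ext i j; simp [Matrix.mul_apply]
    · ext i j; fin_cases i; fin_cases j; simp [Matrix.mul_apply, D, hcl]
  rw [hblock, Matrix.det_fromBlocks₂₂, hinv]
  have hs : (A + Matrix.of fun i j => u i * star (u j)) -
      (Matrix.of fun i (_ : Fin 1) => u i * star l) * D' *
        (Matrix.of fun (_ : Fin 1) j => l * star (u j))
      = A + (Matrix.of fun i (_ : Fin 1) => u i) *
        (Matrix.of fun (_ : Fin 1) j => c⁻¹ * star (u j)) := by
    ext i j
    simp only [Matrix.sub_apply, Matrix.add_apply, Matrix.mul_apply, Matrix.of_apply, D',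
      Finset.univ_unique, Finset.sum_singleton]
    field_simp
    rw [hcl]; ring
  rw [hs, Matrix.det_add_mul _ _ hA]
  have hD : D.det = c := by simp [D]
  rw [hD, mul_assoc]
  congr 2
  rw [Matrix.mul_assoc, Matrix.det_unique]
  simp [Matrix.mul_apply, dotProduct, Matrix.mulVec, Finset.mul_sum, mul_assoc]
end

section
/- Let n ≥ 1 and p > n be integers and let S be an n×n complex Hermitian positive-definite matrix. Then ∫_{ℂ^n} (1 + u^* S^{-2} u)^{-p} du = C_{n,p} · |det S|², where C_{n,p} = π^n (p−n−1)!/(p−1)!. -/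
open MeasureTheory Real Matrix
open scoped ComplexOrder

lemma gammaPow (m : ℕ) (r : ℝ) (hr : 0 < r) :
    ∫ t in Set.Ioi (0:ℝ), t ^ m * Real.exp (-(r * t)) = (r ^ (m + 1))⁻¹ * (m.factorial : ℝ) := by
  have h := Real.integral_rpow_mul_exp_neg_mul_Ioi (a := (m:ℝ) + 1) (r := r) (by positivity) hr
  rw [Real.Gamma_nat_eq_factorial] at h
  have e : (1 / r) ^ ((m:ℝ) + 1) = (r ^ (m + 1))⁻¹ := by
    rw [← Nat.cast_succ, Real.rpow_natCast, one_div, inv_pow]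
  rw [e] at h
  rw [← h]
  simp

lemma gaussC (n : ℕ) (t : ℝ) (ht : 0 < t) :
    ∫ v : Fin n → ℂ, Real.exp (-(t * ∑ i, ‖v i‖ ^ 2)) = (π / t) ^ n := by
  have h := integral_fintype_prod_volume_eq_pow (ι := Fin n)
    (fun z : ℂ => Real.exp (-t * ‖z‖ ^ 2))
  rw [GaussianFourier.integral_rexp_neg_mul_sq_norm ht] at h
  simp only [← Real.exp_sum, Complex.finrank_real_complex] at h
  norm_num at h
  rw [← h]
  simp [Finset.mul_sum]

lemma radialInt (n k : ℕ) :
    ∫ v : Fin n → ℂ, ((1 + ∑ i, ‖v i‖ ^ 2) ^ (n + k + 1))⁻¹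
      = π ^ n * (k.factorial : ℝ) / ((n + k).factorial : ℝ) := by
  let F : (Fin n → ℂ) → ℝ → ℝ := fun v t =>
    t ^ (n + k) * Real.exp (-((1 + ∑ i, ‖v i‖ ^ 2) * t))
  have hF1 : ∀ v, ∫ t in Set.Ioi (0:ℝ), F v t
      = ((1 + ∑ i, ‖v i‖ ^ 2) ^ (n + k + 1))⁻¹ * ((n + k).factorial : ℝ) := fun v =>
    gammaPow (n + k) _ (by positivity)
  have hFe : ∀ v t, F v t = t ^ (n + k) * Real.exp (-t) *
      Real.exp (-(t * ∑ i, ‖v i‖ ^ 2)) := by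
    intro v t
    simp only [F]
    rw [mul_assoc, ← Real.exp_add]
    congr 2
    ring
  have hF2 : ∀ t, 0 < t → ∫ v, F v t = π ^ n * (t ^ k * Real.exp (-(1 * t))) := by
    intro t ht
    simp only [hFe]
    rw [integral_const_mul, gaussC n t ht, div_pow, pow_add, one_mul]
    field_simp
  have hint : Integrable (Function.uncurry F)
      ((volume : Measure (Fin n → ℂ)).prod (volume.restrict (Set.Ioi (0:ℝ)))) := by
    have hc : Continuous (Function.uncurry F) := by
      simp only [F, Function.uncurry_def]
      fun_prop
    rw [integrable_prod_iff' hc.aestronglyMeasurable]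
    constructor
    · filter_upwards [ae_restrict_mem measurableSet_Ioi] with t ht
      apply Integrable.of_integral_ne_zero
      have := hF2 t ht
      simp only [Function.uncurry_apply_pair]
      rw [this]
      have : 0 < t := ht
      positivity
    · have hg : Integrable (fun t : ℝ => π ^ n * (t ^ k * Real.exp (-(1 * t))))
          (volume.restrict (Set.Ioi (0:ℝ))) := by
        apply Integrable.const_mul
        apply Integrable.of_integral_ne_zero
        rw [gammaPow k 1 one_pos]
        positivity
      refine hg.congr ?_
      filter_upwards [ae_restrict_mem measurableSet_Ioi] with t ht
      have ht' : 0 < t := ht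
      rw [← hF2 t ht]
      congr 1
      ext v
      simp only [Function.uncurry_apply_pair]
      rw [Real.norm_of_nonneg]
      simp only [F]
      positivity
  have hs := integral_integral_swap hint
  simp only [hF1] at hs
  rw [integral_mul_const, setIntegral_congr_fun measurableSet_Ioi (fun t ht => hF2 t ht),
    integral_const_mul, gammaPow k 1 one_pos] at hs
  rw [eq_div_iff (by positivity), hs]
  simp

/-- `∫_{ℂⁿ} (1 + u* S⁻² u)^{-p} du = C_{n,p} |det S|²` for a Hermitian positive-definite
matrix `S`, where `C_{n,p} = πⁿ (p-n-1)!/(p-1)!`. -/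
theorem integral_one_add_quadForm_pow_neg
    (n p : ℕ) (hn : 1 ≤ n) (hp : n < p)
    (S : Matrix (Fin n) (Fin n) ℂ) (hS : S.PosDef) :
    ∫ u : Fin n → ℂ, ((1 + (star u ⬝ᵥ ((S ^ 2)⁻¹ *ᵥ u)).re) ^ p)⁻¹
      = (π ^ n * (Nat.factorial (p - n - 1) : ℝ) / (Nat.factorial (p - 1) : ℝ))
        * ‖S.det‖ ^ 2 := by
  obtain ⟨k, rfl⟩ : ∃ k, p = n + k + 1 := ⟨p - n - 1, by omega⟩
  have e1 : n + k + 1 - n - 1 = k := by omega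
  have e2 : n + k + 1 - 1 = n + k := by omega
  rw [e1, e2, ← radialInt]
  have hdet : S.det ≠ 0 := hS.det_pos.ne'
  let f : (Fin n → ℂ) →ₗ[ℝ] (Fin n → ℂ) := (Matrix.toLin' S⁻¹).restrictScalars ℝ
  have hfd : LinearMap.det f = (‖S.det‖ ^ 2)⁻¹ := by
    simp only [f]
    rw [LinearMap.det_restrictScalars, LinearMap.det_toLin', Algebra.norm_complex_apply,
      Matrix.det_nonsing_inv, Ring.inverse_eq_inv', Complex.normSq_inv, Complex.normSq_eq_norm_sq]
  have hpos : 0 < ‖S.det‖ ^ 2 := by positivity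
  have hmap := Measure.map_linearMap_addHaar_eq_smul_addHaar
    (volume : Measure (Fin n → ℂ)) (f := f) (by rw [hfd]; positivity)
  have hq : ∀ u : Fin n → ℂ, (star u ⬝ᵥ ((S ^ 2)⁻¹ *ᵥ u)).re = ∑ i, ‖f u i‖ ^ 2 := by
    intro u
    have hH : (S⁻¹)ᴴ = S⁻¹ := hS.isHermitian.inv
    have : star u ⬝ᵥ ((S ^ 2)⁻¹ *ᵥ u) = star (S⁻¹ *ᵥ u) ⬝ᵥ (S⁻¹ *ᵥ u) := by
      rw [Matrix.star_mulVec, hH, ← Matrix.dotProduct_mulVec, Matrix.mulVec_mulVec, pow_two,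
        Matrix.mul_inv_rev]
    rw [this]
    simp only [dotProduct, Complex.re_sum, f, Pi.star_apply, LinearMap.coe_restrictScalars,
      Matrix.toLin'_apply]
    refine Finset.sum_congr rfl fun i _ => ?_
    rw [Complex.star_def, ← Complex.normSq_eq_conj_mul_self, Complex.ofReal_re,
      Complex.normSq_eq_norm_sq]
  simp only [hq]
  have hfc : Continuous f := f.continuous_of_finiteDimensional
  have hgc : Continuous (fun v : Fin n → ℂ => ((1 + ∑ i, ‖v i‖ ^ 2) ^ (n + k + 1))⁻¹) := by
    refine Continuous.inv₀ (by fun_prop) fun v => ?_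
    positivity
  have h := integral_map (μ := (volume : Measure (Fin n → ℂ))) hfc.aemeasurable
    hgc.aestronglyMeasurable
  rw [← h, hmap, integral_smul_measure, hfd, inv_inv, abs_of_pos hpos,
    ENNReal.toReal_ofReal hpos.le, smul_eq_mul, mul_comm]
end

section
/- Let n ≥ 1 and p > n+1 be integers, let S be an n×n complex Hermitian positive-definite matrix, and let a, b ∈ ℂ^n. Then ∫_{ℂ^n} (a^* u)(u^* b) (1 + u^* S^{-2} u)^{-p} du = C_{n,p} · |det S|² · (a^* S² b)/(p−n−1), where C_{n,p} = π^n (p−n−1)!/(p−1)!. -/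
open MeasureTheory Real Matrix
open scoped ComplexOrder

lemma aux_gamma (k : ℕ) (r : ℝ) (hr : 0 < r) :
    ∫ t in Set.Ioi (0:ℝ), t ^ k * rexp (-(r * t)) = k.factorial * (r ^ (k+1))⁻¹ := by
  have h := integral_rpow_mul_exp_neg_mul_Ioi (a := (k:ℝ)+1) (by positivity) hr
  rw [Real.Gamma_nat_eq_factorial] at h
  simp only [add_sub_cancel_right, Real.rpow_natCast] at h
  rw [h]
  have : ((k:ℝ)+1) = ((k+1 : ℕ) : ℝ) := by push_cast; rfl
  rw [this, Real.rpow_natCast, one_div, inv_pow, mul_comm]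

lemma aux_gamma_int (k : ℕ) (r : ℝ) (hr : 0 < r) :
    IntegrableOn (fun t : ℝ => t ^ k * rexp (-(r * t))) (Set.Ioi 0) := by
  by_contra h
  have h1 := aux_gamma k r hr
  rw [integral_undef h] at h1
  have : 0 < (k.factorial:ℝ) * (r ^ (k+1))⁻¹ := by positivity
  linarith

lemma aux_g (j : ℕ) (t : ℝ) (ht : 0 < t) :
    ∫ z : ℂ, ‖z‖ ^ (2*j) * rexp (-t * ‖z‖ ^ 2) = π * j.factorial * (t ^ (j+1))⁻¹ := by
  have h := Complex.integral_rpow_mul_exp_neg_mul_rpow (p := 2) (q := ((2*j : ℕ):ℝ)) (b := t)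
    (by norm_num) (lt_of_lt_of_le (by norm_num) (Nat.cast_nonneg _)) ht
  have e1 : -(((2*j:ℕ):ℝ) + 2) / 2 = -((j+1 : ℕ):ℝ) := by push_cast; ring
  have e2 : (((2*j:ℕ):ℝ) + 2) / 2 = (j:ℝ) + 1 := by push_cast; ring
  rw [e1, e2, Real.Gamma_nat_eq_factorial, Real.rpow_neg ht.le, Real.rpow_natCast] at h
  simp only [Real.rpow_natCast, Real.rpow_ofNat] at h
  rw [h]; ring

lemma aux_g_int (j : ℕ) (t : ℝ) (ht : 0 < t) :
    Integrable (fun z : ℂ => ‖z‖ ^ (2*j) * rexp (-t * ‖z‖ ^ 2)) := by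
  by_contra h
  have h1 := aux_g j t ht
  rw [integral_undef h] at h1
  have : 0 < π * (j.factorial:ℝ) * (t ^ (j+1))⁻¹ := by positivity
  linarith

lemma aux_prod {n : ℕ} (i : Fin n) (t : ℝ) (v : Fin n → ℂ) :
    ‖v i‖ ^ 2 * rexp (-t * ∑ k, ‖v k‖ ^ 2)
      = ∏ k, (‖v k‖ ^ (2 * (if k = i then 1 else 0)) * rexp (-t * ‖v k‖ ^ 2)) := by
  rw [Finset.prod_mul_distrib, ← Real.exp_sum, Finset.mul_sum]
  congr 1
  rw [Finset.prod_eq_single i] <;> simp +contextual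

lemma aux_v {n : ℕ} (i : Fin n) (t : ℝ) (ht : 0 < t) :
    ∫ v : Fin n → ℂ, ‖v i‖ ^ 2 * rexp (-t * ∑ k, ‖v k‖ ^ 2) = π ^ n * (t ^ (n+1))⁻¹ := by
  simp_rw [aux_prod]
  rw [integral_fintype_prod_volume_eq_prod
    (fun k (z : ℂ) => ‖z‖ ^ (2 * (if k = i then 1 else 0)) * rexp (-t * ‖z‖ ^ 2))]
  simp_rw [aux_g _ t ht]
  have : ∀ k : Fin n, π * ((if k = i then 1 else 0 : ℕ).factorial : ℝ)
      * (t ^ ((if k = i then 1 else 0) + 1))⁻¹ = (π * t⁻¹) * (if k = i then t⁻¹ else 1) := by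
    intro k; split_ifs
    · simp [pow_succ]; ring
    · simp
  simp_rw [this, Finset.prod_mul_distrib]
  simp [pow_succ]; ring

lemma aux_v_int {n : ℕ} (i : Fin n) (t : ℝ) (ht : 0 < t) :
    Integrable (fun v : Fin n → ℂ => ‖v i‖ ^ 2 * rexp (-t * ∑ k, ‖v k‖ ^ 2)) := by
  simp_rw [aux_prod]
  exact Integrable.fintype_prod
    (f := fun k (z : ℂ) => ‖z‖ ^ (2 * (if k = i then 1 else 0)) * rexp (-t * ‖z‖ ^ 2))
    (fun k => aux_g_int _ t ht)

lemma aux_F {n : ℕ} (i : Fin n) (m : ℕ) :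
    Integrable (fun x : ℝ × (Fin n → ℂ) => x.1 ^ (n+1+m) * rexp (-x.1) *
      (‖x.2 i‖ ^ 2 * rexp (-x.1 * ∑ k, ‖x.2 k‖ ^ 2)))
      ((volume.restrict (Set.Ioi 0)).prod volume) := by
  rw [integrable_prod_iff (Continuous.aestronglyMeasurable (by fun_prop))]
  constructor
  · filter_upwards [ae_restrict_mem measurableSet_Ioi] with t ht
    exact (aux_v_int i t ht).const_mul _
  · refine (((aux_gamma_int m 1 one_pos).const_mul (π ^ n))).congr ?_
    filter_upwards [ae_restrict_mem measurableSet_Ioi] with t ht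
    have ht : 0 < t := ht
    have : ∀ v : Fin n → ℂ, ‖t ^ (n+1+m) * rexp (-t) *
      (‖v i‖ ^ 2 * rexp (-t * ∑ k, ‖v k‖ ^ 2))‖ = t ^ (n+1+m) * rexp (-t) *
      (‖v i‖ ^ 2 * rexp (-t * ∑ k, ‖v k‖ ^ 2)) := fun v => by
      rw [Real.norm_of_nonneg]; positivity
    simp_rw [this]
    rw [integral_const_mul, aux_v i t ht, pow_add]
    field_simp

lemma aux_inner {n : ℕ} (i : Fin n) (m : ℕ) (v : Fin n → ℂ) :
    ∫ t in Set.Ioi (0:ℝ), t ^ (n+1+m) * rexp (-t) * (‖v i‖ ^ 2 * rexp (-t * ∑ k, ‖v k‖ ^ 2))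
     = (n+1+m).factorial * (‖v i‖ ^ 2 * ((1 + ∑ k, ‖v k‖ ^ 2) ^ (n+2+m))⁻¹) := by
  have hpos : 0 < 1 + ∑ k, ‖v k‖ ^ 2 := by positivity
  have h := aux_gamma (n+1+m) _ hpos
  have : ∀ t : ℝ, t ^ (n+1+m) * rexp (-t) * (‖v i‖ ^ 2 * rexp (-t * ∑ k, ‖v k‖ ^ 2))
     = ‖v i‖ ^ 2 * (t ^ (n+1+m) * rexp (-((1 + ∑ k, ‖v k‖ ^ 2) * t))) := by
    intro t
    have : -((1 + ∑ k, ‖v k‖ ^ 2) * t) = -t + -t * ∑ k, ‖v k‖ ^ 2 := by ring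
    rw [this, Real.exp_add]; ring
  simp_rw [this]
  rw [integral_const_mul, h, show n+1+m+1 = n+2+m by ring]; ring

lemma aux_diag_int {n : ℕ} (i : Fin n) (m : ℕ) :
    Integrable (fun v : Fin n → ℂ => ‖v i‖ ^ 2 * ((1 + ∑ k, ‖v k‖ ^ 2) ^ (n+2+m))⁻¹) := by
  have h := (aux_F i m).integral_prod_right
  simp only [aux_inner] at h
  have hc : ((n+1+m).factorial : ℝ) ≠ 0 := by positivity
  exact (integrable_const_mul_iff hc.isUnit _).1 h

lemma aux_diag {n : ℕ} (i : Fin n) (m : ℕ) :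
    ∫ v : Fin n → ℂ, ‖v i‖ ^ 2 * ((1 + ∑ k, ‖v k‖ ^ 2) ^ (n+2+m))⁻¹
      = π ^ n * m.factorial / (n+1+m).factorial := by
  have h := integral_integral_swap (f := fun (t : ℝ) (v : Fin n → ℂ) => t ^ (n+1+m) * rexp (-t) *
      (‖v i‖ ^ 2 * rexp (-t * ∑ k, ‖v k‖ ^ 2))) (aux_F i m)
  simp only [aux_inner] at h
  rw [integral_const_mul] at h
  have h2 : ∫ t in Set.Ioi (0:ℝ), ∫ v : Fin n → ℂ, t ^ (n+1+m) * rexp (-t) *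
      (‖v i‖ ^ 2 * rexp (-t * ∑ k, ‖v k‖ ^ 2)) =
      ∫ t in Set.Ioi (0:ℝ), π ^ n * (t ^ m * rexp (-(1 * t))) := by
    refine setIntegral_congr_fun measurableSet_Ioi fun t ht => ?_
    have ht : 0 < t := ht
    rw [integral_const_mul, aux_v i t ht, pow_add]
    field_simp
  rw [h2, integral_const_mul, aux_gamma m 1 one_pos] at h
  have hc : ((n+1+m).factorial : ℝ) ≠ 0 := by positivity
  rw [eq_div_iff hc, mul_comm, ← h]; simp

lemma aux_cov {n : ℕ} (M : Matrix (Fin n) (Fin n) ℂ) (hM : M.det ≠ 0) (g : (Fin n → ℂ) → ℂ) :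
    ∫ u, g u = ((‖M.det‖ ^ 2 : ℝ) : ℂ) * ∫ v, g (M *ᵥ v) := by
  set f : (Fin n → ℂ) →ₗ[ℝ] (Fin n → ℂ) := (Matrix.toLin' M).restrictScalars ℝ with hf
  have hdet : LinearMap.det f = ‖M.det‖ ^ 2 := by
    rw [hf, LinearMap.det_restrictScalars, LinearMap.det_toLin', Algebra.norm_complex_apply,
      Complex.normSq_eq_norm_sq]
  have hne : LinearMap.det f ≠ 0 := by rw [hdet]; positivity
  have hmap := Measure.map_linearMap_addHaar_eq_smul_addHaar (volume : Measure (Fin n → ℂ)) hne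
  have hemb : MeasurableEmbedding f := by
    have := (LinearEquiv.ofIsUnitDet (f := f) (v := Module.finBasis ℝ _) (v' := Module.finBasis ℝ _)
      (by simpa [LinearMap.det_toMatrix] using hne)).toContinuousLinearEquiv.toHomeomorph.measurableEmbedding
    exact this
  have h := hemb.integral_map (μ := volume) g
  rw [hmap, integral_smul_measure, hdet] at h
  have h' : ∫ v, g (M *ᵥ v) = ∫ v, g (f v) := rfl
  rw [h', ← h]
  have hd : ‖M.det‖ ≠ 0 := by positivity
  rw [ENNReal.toReal_ofReal (by positivity), abs_of_nonneg (by positivity), Complex.real_smul]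
  push_cast
  rw [← mul_assoc, mul_inv_cancel₀, one_mul]
  exact_mod_cast pow_ne_zero 2 hd

lemma aux_term_int {n : ℕ} (i j : Fin n) (m : ℕ) :
    Integrable (fun v : Fin n → ℂ => v i * star (v j) *
      ((((1 + ∑ k, ‖v k‖ ^ 2) ^ (n+2+m))⁻¹ : ℝ) : ℂ)) := by
  refine ((aux_diag_int i m).add (aux_diag_int j m)).mono' ?_ (.of_forall fun v => ?_)
  · have hc : Continuous (fun v : Fin n → ℂ => ((1 + ∑ k, ‖v k‖ ^ 2) ^ (n+2+m))⁻¹) :=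
      Continuous.inv₀ (by fun_prop) (fun v => by positivity)
    exact Continuous.aestronglyMeasurable (by fun_prop)
  · have : 0 ≤ ((1 + ∑ k, ‖v k‖ ^ 2) ^ (n+2+m))⁻¹ := by positivity
    simp only [norm_mul, norm_star, Complex.norm_real, Pi.add_apply, Real.norm_of_nonneg this]
    rw [← add_mul]
    refine mul_le_mul_of_nonneg_right ?_ this
    nlinarith [sq_nonneg (‖v i‖ - ‖v j‖), sq_nonneg (‖v i‖), sq_nonneg (‖v j‖)]

lemma aux_term {n : ℕ} (i j : Fin n) (m : ℕ) :
    ∫ v : Fin n → ℂ, v i * star (v j) * ((((1 + ∑ k, ‖v k‖ ^ 2) ^ (n+2+m))⁻¹ : ℝ) : ℂ)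
      = if i = j then ((π ^ n * m.factorial / (n+1+m).factorial : ℝ) : ℂ) else 0 := by
  split_ifs with h
  · subst h
    rw [← aux_diag i m, ← integral_complex_ofReal]
    congr 1; ext v
    rw [Complex.star_def, Complex.mul_conj, Complex.normSq_eq_norm_sq]; push_cast; rfl
  · set d : Fin n → ℂ := fun k => if k = i then -1 else 1 with hd
    have hn : ∀ k, ‖d k‖ = 1 := by intro k; simp only [hd]; split_ifs <;> simp
    have hdet : ‖(Matrix.diagonal d).det‖ = 1 := by
      rw [Matrix.det_diagonal, norm_prod]; simp [hn]
    have key := aux_cov (Matrix.diagonal d) (by intro h0; simp [h0] at hdet)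
      (fun v => v i * star (v j) * ((((1 + ∑ k, ‖v k‖ ^ 2) ^ (n+2+m))⁻¹ : ℝ) : ℂ))
    have hi : d i = -1 := by simp [hd]
    have hj : d j = 1 := by simp [hd, Ne.symm h]
    simp only [hdet, Matrix.mulVec_diagonal, norm_mul, hn, one_mul, hi, hj, neg_mul] at key
    rw [integral_neg] at key
    simp only [one_pow, Complex.ofReal_one, one_mul] at key
    exact self_eq_neg.mp key

lemma aux_main {n : ℕ} (m : ℕ) (c d : Fin n → ℂ) :
    ∫ v : Fin n → ℂ, (star c ⬝ᵥ v) * (star v ⬝ᵥ d) *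
        ((((1 + ∑ k, ‖v k‖ ^ 2) ^ (n+2+m))⁻¹ : ℝ) : ℂ)
      = ((π ^ n * m.factorial / (n+1+m).factorial : ℝ) : ℂ) * (star c ⬝ᵥ d) := by
  have : ∀ v : Fin n → ℂ, (star c ⬝ᵥ v) * (star v ⬝ᵥ d) *
        ((((1 + ∑ k, ‖v k‖ ^ 2) ^ (n+2+m))⁻¹ : ℝ) : ℂ)
      = ∑ i, ∑ j, (star (c i) * d j) * (v i * star (v j) *
        ((((1 + ∑ k, ‖v k‖ ^ 2) ^ (n+2+m))⁻¹ : ℝ) : ℂ)) := by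
    intro v
    simp only [dotProduct, Pi.star_apply]
    rw [Finset.sum_mul_sum]
    simp only [Finset.sum_mul]
    refine Finset.sum_congr rfl fun i _ => Finset.sum_congr rfl fun j _ => ?_
    ring
  simp_rw [this]
  rw [integral_finsetSum _ fun i _ => integrable_finsetSum _ fun j _ =>
    (aux_term_int i j m).const_mul _]
  simp_rw [integral_finsetSum _ fun j _ => (aux_term_int _ j m).const_mul _, integral_const_mul,
    aux_term]
  simp [dotProduct, Finset.mul_sum, mul_comm]

theorem integral_sesquilinear_one_add_quadForm_pow_neg
    (n p : ℕ) (hn : 1 ≤ n) (hp : n + 1 < p)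
    (S : Matrix (Fin n) (Fin n) ℂ) (hS : S.PosDef) (a b : Fin n → ℂ) :
    ∫ u : Fin n → ℂ,
        (star a ⬝ᵥ u) * (star u ⬝ᵥ b)
          * ((((1 + (star u ⬝ᵥ ((S ^ 2)⁻¹ *ᵥ u)).re) ^ p)⁻¹ : ℝ) : ℂ)
      = (((π ^ n * (Nat.factorial (p - n - 1) : ℝ) / (Nat.factorial (p - 1) : ℝ))
            * ‖S.det‖ ^ 2 / ((p : ℝ) - n - 1) : ℝ) : ℂ)
        * (star a ⬝ᵥ (S ^ 2 *ᵥ b)) := by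
  obtain ⟨m, rfl⟩ : ∃ m, p = n + 2 + m := ⟨p - (n+2), by omega⟩
  have hdet : S.det ≠ 0 := hS.det_pos.ne'
  have hu : IsUnit S.det := hdet.isUnit
  have hH : Sᴴ = S := hS.1
  have hq : ∀ v : Fin n → ℂ,
      (star (S *ᵥ v) ⬝ᵥ ((S ^ 2)⁻¹ *ᵥ (S *ᵥ v))).re = ∑ k, ‖v k‖ ^ 2 := by
    intro v
    have e : Sᴴ * ((S ^ 2)⁻¹ * S) = 1 := by
      rw [hH, pow_two, Matrix.mul_inv_rev, Matrix.mul_assoc, Matrix.nonsing_inv_mul _ hu,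
        Matrix.mul_one, Matrix.mul_nonsing_inv _ hu]
    rw [Matrix.star_mulVec, ← Matrix.dotProduct_mulVec, Matrix.mulVec_mulVec, Matrix.mulVec_mulVec,
      Matrix.mul_assoc, e, Matrix.one_mulVec]
    simp [dotProduct, Complex.normSq_eq_norm_sq, ← Complex.normSq_eq_conj_mul_self,
      ← Complex.ofReal_pow]
  rw [aux_cov S hdet]
  have ha : ∀ v : Fin n → ℂ, star a ⬝ᵥ (S *ᵥ v) = star (S *ᵥ a) ⬝ᵥ v := by
    intro v; rw [Matrix.star_mulVec, hH, Matrix.dotProduct_mulVec]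
  have hb : ∀ v : Fin n → ℂ, star (S *ᵥ v) ⬝ᵥ b = star v ⬝ᵥ (S *ᵥ b) := by
    intro v; rw [Matrix.star_mulVec, hH, Matrix.dotProduct_mulVec]
  simp_rw [hq, hb, ha]
  rw [aux_main, ← ha, Matrix.mulVec_mulVec, ← pow_two, ← mul_assoc, ← Complex.ofReal_mul]
  congr 2
  rw [show n + 2 + m - n - 1 = m + 1 by omega, show n + 2 + m - 1 = n + 1 + m by omega,
    Nat.factorial_succ]
  push_cast
  have h1 : ((n:ℝ) + 2 + m - n - 1) = m + 1 := by ring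
  have h2 : (m:ℝ) + 1 ≠ 0 := by positivity
  rw [h1]
  field_simp
end

section
/- Let n ≥ 1 and p > n be integers, let S be an n×n complex Hermitian positive-definite matrix, and let a ∈ ℂ^n. Then for every nonnegative Borel measurable function f : ℝ → [0,∞], ∫_{ℂ^n} f(|a^* u|²) (1 + u^* S^{-2} u)^{-p} du = C_{n,p} · |det S|² · ∫_0^∞ f(‖S a‖² x) · (p−n) (1+x)^{-(p−n+1)} dx, where C_{n,p} = π^n (p−n−1)!/(p−1)!. Equivalently, if u is distributed with density (C_{n,p} |det S|²)^{-1} (1 + u^* S^{-2} u)^{-p} on ℂ^n, then |a^* u|² is distributed as ‖S a‖² X_{p−n−1}, where X_m has density (m+1)(1+x)^{-(m+2)} on (0,∞). -/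
open MeasureTheory Real Matrix Set
open scoped ComplexOrder

lemma aux_polar (g : ℝ → ENNReal) (hg : Measurable g) :
    ∫⁻ z : ℂ, g (‖z‖ ^ 2) = ENNReal.ofReal π * ∫⁻ x in Ioi (0 : ℝ), g x := by
  rw [← Complex.lintegral_comp_polarCoord_symm]
  have h1 : ∀ q ∈ polarCoord.target, ENNReal.ofReal q.1 • g (‖Complex.polarCoord.symm q‖ ^ 2)
      = ENNReal.ofReal q.1 * g (q.1 ^ 2) := by
    intro q _
    rw [Complex.norm_polarCoord_symm, sq_abs, smul_eq_mul]
  rw [setLIntegral_congr_fun polarCoord.open_target.measurableSet h1]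
  have himg : (fun x : ℝ => x ^ 2) '' Ioi 0 = Ioi 0 := by
    ext y
    constructor
    · rintro ⟨x, hx, rfl⟩
      exact pow_pos (show (0:ℝ) < x from hx) 2
    · intro hy
      exact ⟨√y, Real.sqrt_pos.2 hy, Real.sq_sqrt (le_of_lt hy)⟩
  have h2 := lintegral_image_eq_lintegral_abs_deriv_mul (s := Ioi (0:ℝ)) (f := fun x => x ^ 2)
    (f' := fun x => 2 * x) measurableSet_Ioi
    (fun x _ => by simpa using (hasDerivAt_pow 2 x).hasDerivWithinAt)
    (fun x hx y hy h => by
      exact (pow_left_inj₀ (le_of_lt hx) (le_of_lt hy) two_ne_zero).1 h) g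
  rw [himg] at h2
  rw [h2, polarCoord_target, Measure.volume_eq_prod, ← Measure.prod_restrict]
  have h3 := lintegral_prod_mul (μ := volume.restrict (Ioi (0:ℝ)))
    (ν := volume.restrict (Ioo (-π) π)) (f := fun r => ENNReal.ofReal r * g (r ^ 2))
    (g := fun _ => 1) (by fun_prop) (by fun_prop)
  simp only [mul_one] at h3
  rw [h3]
  have h4 : ∀ x ∈ Ioi (0:ℝ), ENNReal.ofReal |2 * x| * g (x ^ 2)
      = 2 * (ENNReal.ofReal x * g (x ^ 2)) := by
    intro x hx
    have hx' : (0:ℝ) < x := hx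
    rw [abs_of_pos (by positivity), ENNReal.ofReal_mul (by norm_num), mul_assoc]
    simp
  rw [setLIntegral_congr_fun measurableSet_Ioi h4, lintegral_const_mul _ (by fun_prop)]
  simp only [lintegral_const, one_mul, Measure.restrict_apply_univ, Real.volume_Ioo]
  rw [show π - -π = π * 2 by ring, ENNReal.ofReal_mul pi_pos.le]
  simp only [ENNReal.ofReal_ofNat]
  ring

lemma aux_one (k : ℕ) (c : ℝ) (hc : 0 < c) :
    ∫⁻ x in Ioi (0 : ℝ), ENNReal.ofReal (((c + x) ^ (k + 2))⁻¹)
      = ENNReal.ofReal (((k : ℝ) + 1)⁻¹ * (c ^ (k + 1))⁻¹) := by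
  have hd : ∀ x ∈ Ici (0:ℝ), HasDerivAt (fun x : ℝ => -(((k : ℝ) + 1)⁻¹ * ((c + x) ^ (k + 1))⁻¹))
      (((c + x) ^ (k + 2))⁻¹) x := by
    intro x hx
    have hx' : (0:ℝ) ≤ x := hx
    have hpos : 0 < c + x := by positivity
    have h := ((((hasDerivAt_id x).const_add c).pow (k + 1)).inv
      (by simpa using (pow_pos hpos (k+1)).ne')).const_mul (((k : ℝ) + 1)⁻¹)
    convert! h.neg using 1
    simp
    field_simp
    ring
  have hpos : ∀ x ∈ Ioi (0:ℝ), 0 ≤ ((c + x) ^ (k + 2))⁻¹ := by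
    intro x hx
    have hx' : (0:ℝ) < x := hx
    positivity
  have hl : Filter.Tendsto (fun x : ℝ => -(((k : ℝ) + 1)⁻¹ * ((c + x) ^ (k + 1))⁻¹))
      Filter.atTop (nhds 0) := by
    have h1 : Filter.Tendsto (fun x : ℝ => ((c + x) ^ (k + 1))) Filter.atTop Filter.atTop :=
      (Filter.tendsto_pow_atTop (by omega)).comp (Filter.tendsto_atTop_add_const_left _ c Filter.tendsto_id)
    have h2 := (h1.inv_tendsto_atTop.const_mul (((k : ℝ) + 1)⁻¹)).neg
    simpa using h2
  have hi := integrableOn_Ioi_deriv_of_nonneg' hd hpos hl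
  have he := integral_Ioi_of_hasDerivAt_of_nonneg' hd hpos hl
  rw [← ofReal_integral_eq_lintegral_ofReal hi
    ((ae_restrict_iff' measurableSet_Ioi).2 (Filter.Eventually.of_forall hpos)), he]
  simp

lemma aux_split (m : ℕ) (F : ℂ → (Fin m → ℂ) → ENNReal)
    (hF : Measurable (Function.uncurry F)) :
    ∫⁻ v : Fin (m + 1) → ℂ, F (v 0) (fun i => v i.succ) = ∫⁻ z : ℂ, ∫⁻ w : Fin m → ℂ, F z w := by
  have h := volume_preserving_piFinSuccAbove (fun _ : Fin (m + 1) => ℂ) 0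
  have h2 := h.lintegral_comp hF
  have h3 := lintegral_prod (μ := (volume : Measure ℂ)) (ν := (volume : Measure (Fin m → ℂ)))
    (Function.uncurry F) hF.aemeasurable
  rw [← Measure.volume_eq_prod] at h3
  simp only [Function.uncurry] at h2 h3
  rw [← h3]
  exact h2

lemma aux_pow (m : ℕ) : ∀ (k : ℕ) (c : ℝ), 0 < c →
    ∫⁻ v : Fin m → ℂ, ENNReal.ofReal (((c + ∑ i, ‖v i‖ ^ 2) ^ (k + m + 1))⁻¹)
      = ENNReal.ofReal (π ^ m * (Nat.factorial k : ℝ) / (Nat.factorial (k + m) : ℝ)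
          * (c ^ (k + 1))⁻¹) := by
  induction m with
  | zero =>
    intro k c hc
    have : (Nat.factorial k : ℝ) ≠ 0 := by positivity
    simp [this, lintegral_unique, volume_pi, Measure.pi_empty_univ]
  | succ m ih =>
    intro k c hc
    have h := aux_split m (fun z w => ENNReal.ofReal (((c + ‖z‖ ^ 2 + ∑ i, ‖w i‖ ^ 2) ^ (k + 1 + m + 1))⁻¹))
      (by unfold Function.uncurry; fun_prop)
    simp only [Fin.sum_univ_succ, ← add_assoc] at h ⊢
    rw [show k + m + 1 + 1 = k + 1 + m + 1 by ring, h]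
    have : ∀ z : ℂ, ∫⁻ w : Fin m → ℂ, ENNReal.ofReal (((c + ‖z‖ ^ 2 + ∑ i, ‖w i‖ ^ 2) ^ (k + 1 + m + 1))⁻¹)
       = ENNReal.ofReal (π ^ m * (Nat.factorial (k+1) : ℝ) / (Nat.factorial (k + 1 + m) : ℝ))
          * ENNReal.ofReal (((c + ‖z‖ ^ 2) ^ (k + 2))⁻¹) := by
      intro z
      rw [ih (k + 1) _ (by positivity), ENNReal.ofReal_mul (by positivity)]
    simp only [this]
    rw [lintegral_const_mul _ (by fun_prop),
      aux_polar (fun x => ENNReal.ofReal (((c + x) ^ (k + 2))⁻¹)) (by fun_prop), aux_one k c hc,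
      ← ENNReal.ofReal_mul (by positivity), ← ENNReal.ofReal_mul (by positivity)]
    congr 1
    rw [show k + 1 + m = k + m + 1 by ring, Nat.factorial_succ k]
    push_cast
    have : (Nat.factorial (k + m + 1) : ℝ) ≠ 0 := by positivity
    field_simp
    ring

lemma aux_unitary (m : ℕ) (b : Fin (m + 1) → ℂ) :
    ∃ U : Matrix (Fin (m + 1)) (Fin (m + 1)) ℂ, Uᴴ * U = 1 ∧
      ∀ v, ‖star b ⬝ᵥ (U *ᵥ v)‖ ^ 2 = (∑ i, ‖b i‖ ^ 2) * ‖v 0‖ ^ 2 := by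
  obtain ⟨b', hb'⟩ : ∃ b' : EuclideanSpace ℂ (Fin (m + 1)), b' = WithLp.toLp 2 b := ⟨_, rfl⟩
  obtain ⟨e, he, hbe⟩ : ∃ e : EuclideanSpace ℂ (Fin (m + 1)), ‖e‖ = 1 ∧ b' = (‖b'‖ : ℂ) • e := by
    by_cases hb : b' = 0
    · exact ⟨EuclideanSpace.single 0 1, by simp, by simp [hb]⟩
    · have : ‖b'‖ ≠ 0 := by simpa using hb
      refine ⟨((‖b'‖ : ℂ)⁻¹) • b', ?_, ?_⟩
      · rw [norm_smul]; simp [this]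
      · rw [smul_smul, mul_inv_cancel₀ (by exact_mod_cast this), one_smul]
  obtain ⟨B, hB⟩ := Orthonormal.exists_orthonormalBasis_extension_of_card_eq (𝕜 := ℂ) (E := EuclideanSpace ℂ (Fin (m + 1)))
    (ι := Fin (m + 1)) (by simp) (v := fun _ => e) (s := {0}) (by
      constructor
      · intro i; simpa [Set.domRestrict] using he
      · intro i j hij
        exact absurd (Subsingleton.elim i j) hij)
  have hB0 : B 0 = e := hB 0 rfl
  have key : (of fun i j => B j i : Matrix (Fin (m + 1)) (Fin (m + 1)) ℂ)ᴴ * (of fun i j => B j i) = 1 := by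
    ext i j
    have := orthonormal_iff_ite.1 B.orthonormal i j
    rw [Matrix.one_apply, ← this]
    simp [Matrix.mul_apply, PiLp.inner_apply, mul_comm]
  refine ⟨of fun i j => B j i, key, fun v => ?_⟩
  set U : Matrix (Fin (m + 1)) (Fin (m + 1)) ℂ := of fun i j => B j i with hU
  have hb : b = (‖b'‖ : ℂ) • (U *ᵥ Pi.single 0 1) := by
    ext i
    have := congrArg (fun x : EuclideanSpace ℂ (Fin (m + 1)) => x i) hbe
    simp only [PiLp.smul_apply] at this
    rw [show b i = b' i by rw [hb']]
    simpa [hU, hB0] using this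
  have hn : ∑ i, ‖b i‖ ^ 2 = ‖b'‖ ^ 2 := by
    rw [EuclideanSpace.norm_sq_eq, hb']
  rw [hn]
  conv_lhs => rw [hb]
  rw [star_smul, smul_dotProduct, star_mulVec, ← dotProduct_mulVec, mulVec_mulVec, key, one_mulVec]
  rw [← Pi.single_star, star_one, single_one_dotProduct, norm_smul, mul_pow]
  simp

lemma aux_linear (n : ℕ) (T : Matrix (Fin n) (Fin n) ℂ) (hT : T.det ≠ 0)
    (F : (Fin n → ℂ) → ENNReal) (hF : Measurable F) :
    ∫⁻ u, F u = ENNReal.ofReal (‖T.det‖ ^ 2) * ∫⁻ v, F (T *ᵥ v) := by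
  let L : (Fin n → ℂ) →ₗ[ℝ] (Fin n → ℂ) := (Matrix.toLin' T).restrictScalars ℝ
  have hL : LinearMap.det L = ‖T.det‖ ^ 2 := by
    simp [L, LinearMap.det_restrictScalars, Algebra.norm_complex_eq, Complex.normSq_eq_norm_sq]
  have hpos : 0 < ‖T.det‖ ^ 2 := by positivity
  have h := Measure.map_linearMap_addHaar_eq_smul_addHaar (volume : Measure (Fin n → ℂ)) (f := L)
    (by rw [hL]; exact hpos.ne')
  have hm : Measurable L := L.continuous_of_finiteDimensional.measurable
  have h2 : ∫⁻ v, F (T *ᵥ v) = ∫⁻ u, F u ∂(Measure.map L volume) := by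
    rw [lintegral_map hF hm]; rfl
  rw [h2, h, lintegral_smul_measure, hL, smul_eq_mul, ← mul_assoc, ← ENNReal.ofReal_mul hpos.le,
    abs_of_pos (inv_pos.2 hpos), mul_inv_cancel₀ hpos.ne']
  simp

/-- If `u` has density proportional to `(1 + u* S⁻² u)^{-p}` on `ℂⁿ`, then `|a* u|²` is
distributed as `‖Sa‖² X_{p-n-1}` where `X_m` has density `(m+1)(1+x)^{-(m+2)}` on `(0,∞)`:
stated as an identity of integrals of an arbitrary nonnegative measurable test function. -/
theorem lintegral_inner_sq_one_add_quadForm_pow_neg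
    (n p : ℕ) (hn : 1 ≤ n) (hp : n < p)
    (S : Matrix (Fin n) (Fin n) ℂ) (hS : S.PosDef) (a : Fin n → ℂ)
    (f : ℝ → ENNReal) (hf : Measurable f) :
    ∫⁻ u : Fin n → ℂ,
        f (‖star a ⬝ᵥ u‖ ^ 2)
          * ENNReal.ofReal (((1 + (star u ⬝ᵥ ((S ^ 2)⁻¹ *ᵥ u)).re) ^ p)⁻¹)
      = ENNReal.ofReal
          ((π ^ n * (Nat.factorial (p - n - 1) : ℝ) / (Nat.factorial (p - 1) : ℝ))
            * ‖S.det‖ ^ 2)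
        * ∫⁻ x in Ioi (0 : ℝ),
            f ((∑ i, ‖(S *ᵥ a) i‖ ^ 2) * x)
              * ENNReal.ofReal (((p : ℝ) - n) * ((1 + x) ^ (p - n + 1))⁻¹) := by
  obtain ⟨m, rfl⟩ : ∃ m, n = m + 1 := ⟨n - 1, by omega⟩
  obtain ⟨k, rfl⟩ : ∃ k, p = k + 1 + m + 1 := ⟨p - m - 2, by omega⟩
  have hdet : S.det ≠ 0 := hS.det_pos.ne'
  have hSu : IsUnit S.det := isUnit_iff_ne_zero.2 hdet
  have hSH : Sᴴ = S := hS.isHermitian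
  obtain ⟨U, hU, hUv⟩ := aux_unitary m (S *ᵥ a)
  have hUdet : ‖U.det‖ = 1 := by
    have h := congrArg (fun M => ‖Matrix.det M‖) hU
    simp only [det_mul, det_conjTranspose, norm_mul, norm_star, det_one, norm_one] at h
    nlinarith [norm_nonneg U.det]
  have hTdet : ‖(S * U).det‖ = ‖S.det‖ := by rw [det_mul, norm_mul, hUdet, mul_one]
  have hT0 : (S * U).det ≠ 0 := by
    rw [← norm_ne_zero_iff, hTdet, norm_ne_zero_iff]; exact hdet
  have hm : Measurable fun u : Fin (m + 1) → ℂ => f (‖star a ⬝ᵥ u‖ ^ 2)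
          * ENNReal.ofReal (((1 + (star u ⬝ᵥ ((S ^ 2)⁻¹ *ᵥ u)).re) ^ (k + 1 + m + 1))⁻¹) := by
    have h1 : Measurable fun u : Fin (m + 1) → ℂ => ‖star a ⬝ᵥ u‖ ^ 2 :=
      Continuous.measurable (by fun_prop)
    have h2 : Measurable fun u : Fin (m + 1) → ℂ => (star u ⬝ᵥ ((S ^ 2)⁻¹ *ᵥ u)).re :=
      Continuous.measurable (by fun_prop)
    fun_prop
  rw [aux_linear (m + 1) (S * U) hT0 _ hm, hTdet]
  have hA : ∀ v, ‖star a ⬝ᵥ ((S * U) *ᵥ v)‖ ^ 2 = (∑ i, ‖(S *ᵥ a) i‖ ^ 2) * ‖v 0‖ ^ 2 := by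
    intro v
    rw [← hUv v, star_mulVec, hSH, ← dotProduct_mulVec, mulVec_mulVec]
  have hM : (S * U)ᴴ * ((S ^ 2)⁻¹ * (S * U)) = 1 := by
    rw [conjTranspose_mul, hSH, pow_two, Matrix.mul_inv_rev, ← hU]
    have e1 : S⁻¹ * S = 1 := nonsing_inv_mul S hSu
    have e2 : S * S⁻¹ = 1 := mul_nonsing_inv S hSu
    calc Uᴴ * S * (S⁻¹ * S⁻¹ * (S * U)) = Uᴴ * (S * S⁻¹) * (S⁻¹ * S) * U := by
          simp only [Matrix.mul_assoc]
      _ = Uᴴ * U := by rw [e1, e2]; simp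
  have hQ : ∀ v : Fin (m + 1) → ℂ,
      (star ((S * U) *ᵥ v) ⬝ᵥ ((S ^ 2)⁻¹ *ᵥ ((S * U) *ᵥ v))).re = ∑ i, ‖v i‖ ^ 2 := by
    intro v
    rw [star_mulVec, ← dotProduct_mulVec, mulVec_mulVec, mulVec_mulVec, Matrix.mul_assoc, hM, one_mulVec]
    simp only [dotProduct, Complex.re_sum]
    refine Finset.sum_congr rfl fun i _ => ?_
    rw [Pi.star_apply, Complex.star_def, Complex.conj_mul']
    norm_cast
  simp only [hA, hQ]
  set r := ∑ i, ‖(S *ᵥ a) i‖ ^ 2 with hr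
  have h := aux_split m (fun z w => f (r * ‖z‖ ^ 2) *
      ENNReal.ofReal (((1 + ‖z‖ ^ 2 + ∑ i, ‖w i‖ ^ 2) ^ (k + 1 + m + 1))⁻¹))
      (by unfold Function.uncurry; fun_prop)
  simp only [Fin.sum_univ_succ, ← add_assoc] at h ⊢
  rw [h]
  have hin : ∀ z : ℂ, ∫⁻ w : Fin m → ℂ, f (r * ‖z‖ ^ 2) *
      ENNReal.ofReal (((1 + ‖z‖ ^ 2 + ∑ i, ‖w i‖ ^ 2) ^ (k + 1 + m + 1))⁻¹)
      = f (r * ‖z‖ ^ 2) * ENNReal.ofReal (π ^ m * (Nat.factorial (k+1) : ℝ) / (Nat.factorial (k + 1 + m) : ℝ)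
          * ((1 + ‖z‖ ^ 2) ^ (k + 2))⁻¹) := by
    intro z
    rw [lintegral_const_mul _ (by fun_prop), aux_pow m (k + 1) _ (by positivity)]
  simp only [hin]
  rw [aux_polar (fun x => f (r * x) * ENNReal.ofReal (π ^ m * (Nat.factorial (k+1) : ℝ) /
    (Nat.factorial (k + 1 + m) : ℝ) * ((1 + x) ^ (k + 2))⁻¹)) (by fun_prop)]
  rw [← mul_assoc, ← ENNReal.ofReal_mul (by positivity),
    ← lintegral_const_mul _ (by fun_prop), ← lintegral_const_mul _ (by fun_prop)]
  refine setLIntegral_congr_fun measurableSet_Ioi fun x hx => ?_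
  have hx' : (0 : ℝ) < x := hx
  simp only [mul_left_comm _ (f _)]
  congr 1
  rw [← ENNReal.ofReal_mul (by positivity), ← ENNReal.ofReal_mul (by positivity)]
  congr 1
  rw [show k + 1 + m + 1 - (m + 1) - 1 = k by omega, show k + 1 + m + 1 - 1 = k + 1 + m by omega,
    show k + 1 + m + 1 - (m + 1) + 1 = k + 2 by omega, Nat.factorial_succ k]
  push_cast
  ring
end

section
/- Let n ≥ 1 and p ≥ 0 be integers, let S be an n×n complex Hermitian positive-definite matrix, and let a, b ∈ ℂ^n. Then ∫_{E_S} (a^* u)(u^* b) (1 − u^* S^{-2} u)^p du = D_{n,p} · |det S|² · (a^* S² b)/(n+p+1), where E_S = {u ∈ ℂ^n : u^* S^{-2} u ≤ 1} and D_{n,p} = π^n p!/(p+n)!. -/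
open MeasureTheory Real Matrix
open scoped ComplexOrder

/-- truncated weight -/
noncomputable def wt (p : ℕ) (s : ℝ) : ℝ := if s ≤ 1 then (1 - s) ^ p else 0

lemma beta_aux (p : ℕ) : ∀ m : ℕ, ∫ y in (0:ℝ)..1, y ^ (2 * m + 1) * (1 - y ^ 2) ^ p
    = (m.factorial : ℝ) * p.factorial / (2 * (m + 1 + p).factorial) := by
  induction p with
  | zero =>
    intro m
    simp only [pow_zero, mul_one, integral_pow, Nat.factorial_zero, Nat.cast_one, add_zero,
      Nat.factorial_succ]
    have : (m.factorial : ℝ) ≠ 0 := by positivity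
    push_cast
    field_simp
    simp
    ring
  | succ p ih =>
    intro m
    have h1 : ∀ y : ℝ, y ^ (2 * m + 1) * (1 - y ^ 2) ^ (p + 1)
        = y ^ (2 * m + 1) * (1 - y ^ 2) ^ p - y ^ (2 * (m + 1) + 1) * (1 - y ^ 2) ^ p := by
      intro y; ring
    simp_rw [h1]
    rw [intervalIntegral.integral_sub, ih, ih]
    · have e1 : m + 1 + 1 + p = (m + 1 + p) + 1 := by ring
      have e2 : m + 1 + (p + 1) = (m + 1 + p) + 1 := by ring
      rw [e1, e2, Nat.factorial_succ (m + 1 + p), Nat.factorial_succ m, Nat.factorial_succ p]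
      have : ((m + 1 + p).factorial : ℝ) ≠ 0 := by positivity
      push_cast
      have : (m:ℝ) + 1 + p + 1 ≠ 0 := by positivity
      field_simp
      ring
    · apply Continuous.intervalIntegrable; fun_prop
    · apply Continuous.intervalIntegrable; fun_prop

lemma radial_aux (p m : ℕ) : ∫ y in Set.Ioi (0:ℝ), y ^ (2 * m + 1) • wt p (y ^ 2)
    = (m.factorial : ℝ) * p.factorial / (2 * (m + 1 + p).factorial) := by
  rw [← beta_aux, intervalIntegral.integral_of_le zero_le_one]
  rw [← integral_indicator measurableSet_Ioi, ← integral_indicator measurableSet_Ioc]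
  congr 1
  ext y
  simp only [Set.indicator, Set.mem_Ioi, Set.mem_Ioc, wt, smul_eq_mul]
  by_cases h0 : 0 < y
  · have : y ^ 2 ≤ 1 ↔ y ≤ 1 := by
      rw [sq_le_one_iff₀ h0.le]
    by_cases h1 : y ≤ 1 <;> simp [h0, h1, this]
  · simp [h0]

lemma cov (n : ℕ) (M : Matrix (Fin n) (Fin n) ℂ) (hM : M.det ≠ 0) (f : (Fin n → ℂ) → ℂ) :
    ∫ u, f u = ((‖M.det‖ ^ 2 : ℝ) : ℂ) * ∫ v, f (M *ᵥ v) := by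
  let L : (Fin n → ℂ) →ₗ[ℝ] (Fin n → ℂ) := (Matrix.toLin' M).restrictScalars ℝ
  have hL : LinearMap.det L = ‖M.det‖ ^ 2 := by
    simp only [L]
    rw [LinearMap.det_restrictScalars, LinearMap.det_toLin', Algebra.norm_complex_apply,
      Complex.normSq_eq_norm_sq]
  have hL0 : LinearMap.det L ≠ 0 := by rw [hL]; positivity
  have hmap := Measure.map_linearMap_addHaar_eq_smul_addHaar (volume : Measure (Fin n → ℂ)) hL0
  let e := (LinearEquiv.ofIsUnitDet (f := L) (v := Module.finBasis ℝ _) (v' := Module.finBasis ℝ _)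
    (by rw [LinearMap.det_toMatrix]; exact hL0.isUnit)).toContinuousLinearEquiv.toHomeomorph.toMeasurableEquiv
  have he : (e : (Fin n → ℂ) → (Fin n → ℂ)) = L := rfl
  have h1 : ∫ v, f (M *ᵥ v) = ∫ u, f u ∂(Measure.map L volume) := by
    rw [← he, integral_map_equiv]
    rfl
  rw [h1, hmap, integral_smul_measure, hL]
  rw [ENNReal.toReal_ofReal (abs_nonneg _), abs_of_nonneg (by positivity), Complex.real_smul,
    ← mul_assoc, ← Complex.ofReal_mul, mul_inv_cancel₀ (by positivity)]
  simp

lemma J_aux (n p : ℕ) (hn : 1 ≤ n) :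
    ∫ v : Fin n → ℂ, wt p (∑ i, ‖v i‖ ^ 2) = π ^ n * p.factorial / (p + n).factorial := by
  obtain ⟨m, rfl⟩ : ∃ m, n = m + 1 := ⟨n - 1, by omega⟩
  let e : (Fin (m+1) → ℂ) ≃L[ℝ] EuclideanSpace ℂ (Fin (m+1)) :=
    (PiLp.continuousLinearEquiv 2 ℝ (fun _ : Fin (m+1) => ℂ)).symm
  let μ : Measure (EuclideanSpace ℂ (Fin (m+1))) := Measure.map e volume
  have : μ.IsAddHaarMeasure := e.isAddHaarMeasure_map volume
  have hnorm : ∀ v, ‖e v‖ ^ 2 = ∑ i, ‖v i‖ ^ 2 := by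
    intro v; rw [EuclideanSpace.norm_sq_eq]; rfl
  have h1 : ∫ v : Fin (m+1) → ℂ, wt p (∑ i, ‖v i‖ ^ 2) = ∫ x, wt p (‖x‖ ^ 2) ∂μ := by
    have := integral_map_equiv (μ := volume) e.toHomeomorph.toMeasurableEquiv
      (fun x => wt p (‖x‖ ^ 2))
    simp_rw [← hnorm]
    exact this.symm
  have hfr : Module.finrank ℝ (EuclideanSpace ℂ (Fin (m+1))) = 2 * (m + 1) := by
    rw [← e.toLinearEquiv.finrank_eq, Module.finrank_pi_fintype]
    simp [Complex.finrank_real_complex, mul_comm]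
  have hball : μ.real (Metric.ball 0 1) = π ^ (m+1) / (m+1).factorial := by
    have hv := Complex.volume_sum_rpow_lt_one (Fin (m+1)) (p := 2) (by norm_num)
    have hpre : e ⁻¹' (Metric.ball 0 1) = {x : Fin (m+1) → ℂ | ∑ i, ‖x i‖ ^ (2:ℝ) < 1} := by
      ext x
      simp only [Set.mem_preimage, mem_ball_zero_iff, Set.mem_ofPred_eq, Real.rpow_two]
      rw [← hnorm, sq_lt_one_iff₀ (norm_nonneg _)]
    rw [measureReal_def, Measure.map_apply e.continuous.measurable measurableSet_ball, hpre, hv,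
      ENNReal.toReal_ofReal]
    · have : (2 * (Fintype.card (Fin (m+1)) : ℝ) / 2 + 1) = ((m + 1 : ℕ) : ℝ) + 1 := by
        simp
      rw [this, Real.Gamma_nat_eq_factorial]
      have : (2 / 2 + 1 : ℝ) = 2 := by norm_num
      rw [this, Real.Gamma_two]; simp
    · positivity
  rw [h1, integral_fun_norm_addHaar μ (fun y => wt p (y ^ 2)), hfr, hball]
  have : 2 * (m + 1) - 1 = 2 * m + 1 := by omega
  rw [this, radial_aux, add_comm p, Nat.factorial_succ m]
  simp only [nsmul_eq_mul, smul_eq_mul]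
  have : (m.factorial : ℝ) ≠ 0 := by positivity
  push_cast
  field_simp

lemma wt_meas (p : ℕ) : Measurable (wt p) := by
  unfold wt
  exact Measurable.ite measurableSet_Iic (by fun_prop) measurable_const

lemma integ (n p : ℕ) (f : (Fin n → ℂ) → ℂ) (hf : Continuous f) :
    Integrable (fun v : Fin n → ℂ => f v * (wt p (∑ i, ‖v i‖ ^ 2) : ℂ)) := by
  have hcl : IsClosed {v : Fin n → ℂ | ∑ i, ‖v i‖ ^ 2 ≤ 1} :=
    isClosed_le (by fun_prop) continuous_const
  have hK : IsCompact {v : Fin n → ℂ | ∑ i, ‖v i‖ ^ 2 ≤ 1} := by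
    refine (isCompact_closedBall (0 : Fin n → ℂ) 1).of_isClosed_subset hcl ?_
    intro v hv
    rw [mem_closedBall_zero_iff, pi_norm_le_iff_of_nonneg zero_le_one]
    intro i
    have : ‖v i‖ ^ 2 ≤ ∑ i, ‖v i‖ ^ 2 :=
      Finset.single_le_sum (f := fun i => ‖v i‖ ^ 2) (fun _ _ => by positivity) (Finset.mem_univ i)
    exact (sq_le_one_iff₀ (norm_nonneg _)).1 (this.trans hv)
  have h : IntegrableOn (fun v : Fin n → ℂ => f v * (((1 - ∑ i, ‖v i‖ ^ 2) ^ p : ℝ) : ℂ))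
      {v : Fin n → ℂ | ∑ i, ‖v i‖ ^ 2 ≤ 1} := by
    refine ContinuousOn.integrableOn_compact hK (Continuous.continuousOn ?_)
    fun_prop
  rw [← integrable_indicator_iff hcl.measurableSet] at h
  refine h.congr (Filter.Eventually.of_forall fun v => ?_)
  by_cases hv : ∑ i, ‖v i‖ ^ 2 ≤ 1 <;> simp [Set.indicator, wt, hv]

lemma off_diag (n p : ℕ) (i j : Fin n) (hij : i ≠ j) :
    ∫ v : Fin n → ℂ, v i * star (v j) * (wt p (∑ k, ‖v k‖ ^ 2) : ℂ) = 0 := by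
  let d : Fin n → ℂ := fun k => if k = i then -1 else 1
  have hd : (Matrix.diagonal d).det = -1 := by
    simp [Matrix.det_diagonal, d, Finset.prod_ite_eq']
  have h := cov n (Matrix.diagonal d) (by rw [hd]; norm_num)
    (fun v => v i * star (v j) * (wt p (∑ k, ‖v k‖ ^ 2) : ℂ))
  have hn : ∀ (v : Fin n → ℂ) k, ‖d k * v k‖ = ‖v k‖ := by
    intro v k
    by_cases hk : k = i <;> simp [d, hk]
  have hdi : d i = -1 := by simp [d]
  have hdj : d j = 1 := by simp [d, hij.symm]
  simp only [Matrix.mulVec_diagonal, hn, hd, hdi, hdj] at h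
  have h2 : ∀ v : Fin n → ℂ, -1 * v i * star (1 * v j) * (wt p (∑ k, ‖v k‖ ^ 2) : ℂ)
      = -(v i * star (v j) * (wt p (∑ k, ‖v k‖ ^ 2) : ℂ)) := by
    intro v; simp
  simp only [h2, integral_neg] at h
  simp only [norm_neg, norm_one, one_pow, Complex.ofReal_one, one_mul] at h
  exact self_eq_neg.1 h

lemma diag_swap (n p : ℕ) (i j : Fin n) :
    ∫ v : Fin n → ℂ, v i * star (v i) * (wt p (∑ k, ‖v k‖ ^ 2) : ℂ)
      = ∫ v : Fin n → ℂ, v j * star (v j) * (wt p (∑ k, ‖v k‖ ^ 2) : ℂ) := by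
  have h := (volume_measurePreserving_piCongrLeft (fun _ : Fin n => ℂ)
    (Equiv.swap i j)).integral_comp' (fun v => v j * star (v j) * (wt p (∑ k, ‖v k‖ ^ 2) : ℂ))
  rw [← h]
  congr 1
  ext v
  have h1 : ∀ k, (MeasurableEquiv.piCongrLeft (fun _ : Fin n => ℂ) (Equiv.swap i j)) v
      (Equiv.swap i j k) = v k := fun k =>
    MeasurableEquiv.piCongrLeft_apply_apply (β := fun _ : Fin n => ℂ) (Equiv.swap i j) v k
  have h3 : ∑ k, ‖(MeasurableEquiv.piCongrLeft (fun _ : Fin n => ℂ) (Equiv.swap i j)) v k‖ ^ 2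
      = ∑ k, ‖v k‖ ^ 2 := by
    rw [← Equiv.sum_comp (Equiv.swap i j)]
    exact Finset.sum_congr rfl fun k _ => by rw [h1]
  have h2 := h1 i
  rw [Equiv.swap_apply_left] at h2
  rw [h2, h3]

lemma diag_val (n p : ℕ) (hn : 1 ≤ n) (i : Fin n) :
    ∫ v : Fin n → ℂ, v i * star (v i) * (wt p (∑ k, ‖v k‖ ^ 2) : ℂ)
      = ((π ^ n * p.factorial / (p + n + 1).factorial : ℝ) : ℂ) := by
  have h1 : ∑ j : Fin n, ∫ v : Fin n → ℂ, v j * star (v j) * (wt p (∑ k, ‖v k‖ ^ 2) : ℂ)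
      = n * ∫ v : Fin n → ℂ, v i * star (v i) * (wt p (∑ k, ‖v k‖ ^ 2) : ℂ) := by
    rw [Finset.sum_congr rfl (fun j _ => diag_swap n p j i)]
    simp
  have h2 : ∑ j : Fin n, ∫ v : Fin n → ℂ, v j * star (v j) * (wt p (∑ k, ‖v k‖ ^ 2) : ℂ)
      = (∫ v : Fin n → ℂ, (wt p (∑ k, ‖v k‖ ^ 2) : ℂ))
        - ∫ v : Fin n → ℂ, (wt (p + 1) (∑ k, ‖v k‖ ^ 2) : ℂ) := by
    rw [← integral_finsetSum]
    · rw [← integral_sub]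
      · congr 1
        ext v
        rw [← Finset.sum_mul]
        have : ∑ k, v k * star (v k) = ((∑ k, ‖v k‖ ^ 2 : ℝ) : ℂ) := by
          push_cast
          refine Finset.sum_congr rfl fun k _ => ?_
          exact Complex.mul_conj' (v k)
        rw [this, ← Complex.ofReal_mul, ← Complex.ofReal_sub]
        congr 1
        simp only [wt]
        split_ifs
        · ring
        · simp
      · simpa using integ n p (fun _ => 1) continuous_const
      · simpa using integ n (p + 1) (fun _ => 1) continuous_const
    · intro j _
      exact integ n p (fun v => v j * star (v j)) (by fun_prop)
  rw [h1, integral_complex_ofReal, integral_complex_ofReal, J_aux n p hn, J_aux n (p + 1) hn] at h2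
  have hn0 : (n : ℂ) ≠ 0 := by exact_mod_cast (by omega : n ≠ 0)
  apply mul_left_cancel₀ hn0
  rw [h2]
  have e : p + 1 + n = p + n + 1 := by ring
  rw [e, Nat.factorial_succ (p + n), Nat.factorial_succ p, ← Complex.ofReal_natCast n, ← Complex.ofReal_sub,
    ← Complex.ofReal_mul]
  congr 1
  have : ((p + n).factorial : ℝ) ≠ 0 := by positivity
  have : (p : ℝ) + n + 1 ≠ 0 := by positivity
  push_cast
  field_simp
  ring

lemma std_case (n p : ℕ) (hn : 1 ≤ n) (a b : Fin n → ℂ) :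
    ∫ v : Fin n → ℂ, (star a ⬝ᵥ v) * (star v ⬝ᵥ b) * (wt p (∑ k, ‖v k‖ ^ 2) : ℂ)
      = ((π ^ n * p.factorial / (p + n + 1).factorial : ℝ) : ℂ) * (star a ⬝ᵥ b) := by
  have h1 : ∀ v : Fin n → ℂ, (star a ⬝ᵥ v) * (star v ⬝ᵥ b) * (wt p (∑ k, ‖v k‖ ^ 2) : ℂ)
      = ∑ i, ∑ j, (star (a i) * b j) * (v i * star (v j) * (wt p (∑ k, ‖v k‖ ^ 2) : ℂ)) := by
    intro v
    simp only [dotProduct, Pi.star_apply]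
    rw [Finset.sum_mul_sum, Finset.sum_mul]
    refine Finset.sum_congr rfl fun i _ => ?_
    rw [Finset.sum_mul]
    refine Finset.sum_congr rfl fun j _ => ?_
    ring
  have hI : ∀ i j : Fin n, Integrable (fun v : Fin n → ℂ =>
      (star (a i) * b j) * (v i * star (v j) * (wt p (∑ k, ‖v k‖ ^ 2) : ℂ))) := fun i j =>
    (integ n p (fun v => v i * star (v j)) (by fun_prop)).const_mul _
  simp_rw [h1]
  rw [integral_finsetSum _ (fun i _ => integrable_finsetSum _ (fun j _ => hI i j))]
  simp only [dotProduct, Pi.star_apply]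
  rw [Finset.mul_sum]
  refine Finset.sum_congr rfl fun i _ => ?_
  rw [integral_finsetSum _ (fun j _ => hI i j), Finset.sum_eq_single i]
  · rw [integral_const_mul, diag_val n p hn, mul_comm]
  · intro j _ hj
    rw [integral_const_mul, off_diag n p i j hj.symm, mul_zero]
  · simp

/-- `∫_{E_S} (a* u)(u* b)(1 - u* S⁻² u)^p du = D_{n,p} |det S|² (a* S² b)/(n+p+1)`
where `E_S = {u : u* S⁻² u ≤ 1}` and `D_{n,p} = πⁿ p!/(p+n)!`. -/
theorem integral_sesquilinear_one_sub_quadForm_pow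
    (n p : ℕ) (hn : 1 ≤ n)
    (S : Matrix (Fin n) (Fin n) ℂ) (hS : S.PosDef) (a b : Fin n → ℂ) :
    ∫ u in {u : Fin n → ℂ | (star u ⬝ᵥ ((S ^ 2)⁻¹ *ᵥ u)).re ≤ 1},
        (star a ⬝ᵥ u) * (star u ⬝ᵥ b)
          * (((1 - (star u ⬝ᵥ ((S ^ 2)⁻¹ *ᵥ u)).re) ^ p : ℝ) : ℂ)
      = (((π ^ n * (Nat.factorial p : ℝ) / (Nat.factorial (p + n) : ℝ))
            * ‖S.det‖ ^ 2 / ((n : ℝ) + p + 1) : ℝ) : ℂ)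
        * (star a ⬝ᵥ (S ^ 2 *ᵥ b)) := by
  have hdet : S.det ≠ 0 := hS.det_pos.ne'
  have hU : IsUnit S.det := hdet.isUnit
  have hH : Sᴴ = S := hS.isHermitian
  have hstar : ∀ v : Fin n → ℂ, star (S *ᵥ v) = star v ᵥ* S := by
    intro v; rw [star_mulVec, hH]
  have hq : ∀ v : Fin n → ℂ, (star (S *ᵥ v) ⬝ᵥ ((S ^ 2)⁻¹ *ᵥ (S *ᵥ v))).re = ∑ k, ‖v k‖ ^ 2 := by
    intro v
    have hm : S * ((S ^ 2)⁻¹ * S) = 1 := by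
      rw [pow_two, Matrix.mul_inv_rev, Matrix.mul_assoc, Matrix.nonsing_inv_mul _ hU,
        Matrix.mul_one, Matrix.mul_nonsing_inv _ hU]
    rw [hstar, ← dotProduct_mulVec, mulVec_mulVec, mulVec_mulVec, Matrix.mul_assoc, hm, one_mulVec]
    simp only [dotProduct, Pi.star_apply, Complex.re_sum]
    refine Finset.sum_congr rfl fun k _ => ?_
    rw [mul_comm, show v k * star (v k) = ((‖v k‖ ^ 2 : ℝ) : ℂ) by
      push_cast; exact Complex.mul_conj' (v k), Complex.ofReal_re]
  have hmeas : MeasurableSet {u : Fin n → ℂ | (star u ⬝ᵥ ((S ^ 2)⁻¹ *ᵥ u)).re ≤ 1} := by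
    refine (isClosed_le ?_ continuous_const).measurableSet
    fun_prop
  have h1 : ∫ u in {u : Fin n → ℂ | (star u ⬝ᵥ ((S ^ 2)⁻¹ *ᵥ u)).re ≤ 1},
        (star a ⬝ᵥ u) * (star u ⬝ᵥ b)
          * (((1 - (star u ⬝ᵥ ((S ^ 2)⁻¹ *ᵥ u)).re) ^ p : ℝ) : ℂ)
      = ∫ u : Fin n → ℂ, (star a ⬝ᵥ u) * (star u ⬝ᵥ b)
          * (wt p (star u ⬝ᵥ ((S ^ 2)⁻¹ *ᵥ u)).re : ℂ) := by
    rw [← integral_indicator hmeas]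
    congr 1
    ext u
    by_cases hu : (star u ⬝ᵥ ((S ^ 2)⁻¹ *ᵥ u)).re ≤ 1 <;> simp [Set.indicator, wt, hu]
  rw [h1, cov n S hdet]
  have h2 : ∀ v : Fin n → ℂ, (star a ⬝ᵥ (S *ᵥ v)) * (star (S *ᵥ v) ⬝ᵥ b)
      = (star (S *ᵥ a) ⬝ᵥ v) * (star v ⬝ᵥ (S *ᵥ b)) := by
    intro v
    rw [hstar, hstar, ← dotProduct_mulVec, ← dotProduct_mulVec]
  simp_rw [hq, h2]
  rw [std_case n p hn, hstar, ← dotProduct_mulVec, mulVec_mulVec, ← pow_two, ← mul_assoc,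
    ← Complex.ofReal_mul]
  congr 2
  rw [Nat.factorial_succ]
  have : ((p + n).factorial : ℝ) ≠ 0 := by positivity
  have : (n : ℝ) + p + 1 ≠ 0 := by positivity
  have : (p : ℝ) + n + 1 ≠ 0 := by positivity
  push_cast
  field_simp
  ring
end

section
/- Let n ≥ 1 and p ≥ 0 be integers, let S be an n×n complex Hermitian positive-definite matrix, and let a ∈ ℂ^n. Then for every nonnegative Borel measurable function f : ℝ → [0,∞], ∫_{E_S} f(|a^* u|²) (1 − u^* S^{-2} u)^p du = D_{n,p} · |det S|² · ∫_0^1 f(‖S a‖² y) · (p+n) (1−y)^{p+n−1} dy, where E_S = {u ∈ ℂ^n : u^* S^{-2} u ≤ 1} and D_{n,p} = π^n p!/(p+n)!. Equivalently, if u is distributed with density (D_{n,p} |det S|²)^{-1} (1 − u^* S^{-2} u)^p on E_S, then |a^* u|² is distributed as ‖S a‖² Y_{p+n+1}, where Y_m has density (m−1)(1−y)^{m−2} on (0,1). -/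
open MeasureTheory Real Matrix Set
open scoped ComplexOrder

/-- truncated power `t_+^p` -/
noncomputable def truncPow (p : ℕ) : ℝ → ENNReal :=
  (Ici (0 : ℝ)).indicator (fun t => ENNReal.ofReal (t ^ p))

theorem measurable_truncPow (p : ℕ) : Measurable (truncPow p) := by
  unfold truncPow
  exact Measurable.indicator (by fun_prop) measurableSet_Ici

theorem lintegral_complex_normSq (g : ℝ → ENNReal) (hg : Measurable g) :
    ∫⁻ z : ℂ, g (‖z‖ ^ 2) = ENNReal.ofReal π * ∫⁻ y in Ioi (0 : ℝ), g y := by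
  have himg : (fun r : ℝ => r ^ 2) '' Ioi (0 : ℝ) = Ioi 0 := by
    ext y
    simp only [mem_image, mem_Ioi]
    constructor
    · rintro ⟨x, hx, rfl⟩
      positivity
    · intro hy
      exact ⟨√y, Real.sqrt_pos.2 hy, Real.sq_sqrt hy.le⟩
  have h2 := lintegral_image_eq_lintegral_abs_deriv_mul (s := Ioi (0 : ℝ))
    (f := fun r : ℝ => r ^ 2) (f' := fun r => 2 * r) measurableSet_Ioi
    (fun x _ => by simpa using (hasDerivAt_pow 2 x).hasDerivWithinAt)
    (fun x hx y hy hxy => (pow_left_inj₀ (le_of_lt hx) (le_of_lt hy) two_ne_zero).1 hxy) g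
  rw [himg] at h2
  rw [h2, ← Complex.lintegral_comp_polarCoord_symm]
  simp only [Complex.norm_polarCoord_symm, sq_abs, polarCoord_target, smul_eq_mul]
  rw [Measure.volume_eq_prod, setLIntegral_prod _ (by fun_prop)]
  simp only [lintegral_const, Measure.restrict_apply, MeasurableSet.univ, univ_inter,
    Real.volume_Ioo]
  rw [lintegral_mul_const _ (by fun_prop), mul_comm, ← lintegral_const_mul _ (by fun_prop),
    ← lintegral_const_mul _ (by fun_prop)]
  refine setLIntegral_congr_fun measurableSet_Ioi fun r hr => ?_
  have hr' : (0 : ℝ) < r := hr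
  rw [← mul_assoc, ← mul_assoc, ← ENNReal.ofReal_mul (by linarith [Real.pi_pos, hr']),
    ← ENNReal.ofReal_mul (by positivity), abs_of_pos (by positivity)]
  congr 2
  ring

theorem lintegral_truncPow (q : ℕ) (t : ℝ) :
    ∫⁻ y in Ioi (0 : ℝ), truncPow q (t - y)
      = ENNReal.ofReal (1 / ((q : ℝ) + 1)) * truncPow (q + 1) t := by
  rcases lt_or_ge t 0 with ht | ht
  · have : truncPow (q + 1) t = 0 := by simp [truncPow, ht]
    rw [this, mul_zero]
    rw [setLIntegral_congr_fun (g := fun _ => 0) measurableSet_Ioi, lintegral_zero]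
    intro y hy
    have hy' : (0 : ℝ) < y := hy
    have : t - y < 0 := by linarith
    simp only [truncPow]
    rw [indicator_of_notMem]
    simpa using this
  · have e : ∀ y, truncPow q (t - y) =
        (Iic t).indicator (fun y => ENNReal.ofReal ((t - y) ^ q)) y := by
      intro y
      simp only [truncPow, indicator, mem_Ici, mem_Iic, sub_nonneg]
    simp_rw [e]
    rw [lintegral_indicator measurableSet_Iic, Measure.restrict_restrict measurableSet_Iic,
      Iic_inter_Ioi, ← ofReal_integral_eq_lintegral_ofReal]
    · rw [← intervalIntegral.integral_of_le ht]
      have : ∫ y in (0 : ℝ)..t, (t - y) ^ q = 1 / ((q : ℝ) + 1) * t ^ (q + 1) := by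
        rw [intervalIntegral.integral_comp_sub_left (fun y => y ^ q)]
        simp
        ring
      rw [this, ENNReal.ofReal_mul (by positivity)]
      simp [truncPow, ht]
    · exact (Continuous.integrableOn_Icc (by fun_prop)).mono_set Ioc_subset_Icc_self
    · refine (ae_restrict_iff' measurableSet_Ioc).2 (Filter.Eventually.of_forall fun y hy => ?_)
      have := hy.2
      exact pow_nonneg (by linarith) _

theorem lintegral_fin_succ (m : ℕ) (F : ℂ → (Fin m → ℂ) → ENNReal)
    (hF : Measurable (Function.uncurry F)) :
    ∫⁻ w : Fin (m + 1) → ℂ, F (w 0) (fun i => w i.succ) = ∫⁻ z, ∫⁻ v, F z v := by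
  have h := (volume_preserving_piFinSuccAbove (fun _ : Fin (m + 1) => ℂ) 0).lintegral_comp hF
  rw [Measure.volume_eq_prod, lintegral_prod _ hF.aemeasurable] at h
  exact h

theorem lintegral_truncPow_pi (p m : ℕ) (t : ℝ) :
    ∫⁻ w : Fin m → ℂ, truncPow p (t - ∑ i, ‖w i‖ ^ 2)
      = ENNReal.ofReal (π ^ m * (Nat.factorial p : ℝ) / (Nat.factorial (p + m) : ℝ))
        * truncPow (p + m) t := by
  induction m generalizing t with
  | zero =>
    have : (p.factorial : ℝ) ≠ 0 := by positivity
    simp [this, lintegral_unique, volume_pi]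
  | succ m ih =>
    have := measurable_truncPow p
    have h := lintegral_fin_succ m (fun z v => truncPow p (t - ‖z‖ ^ 2 - ∑ i, ‖v i‖ ^ 2))
      (by simp only [Function.uncurry_def]; fun_prop)
    simp_rw [Fin.sum_univ_succ, ← sub_sub]
    rw [h]
    simp_rw [ih]
    have := measurable_truncPow (p + m)
    rw [lintegral_const_mul _ (by fun_prop),
      lintegral_complex_normSq (fun y => truncPow (p + m) (t - y)) (by fun_prop),
      lintegral_truncPow, ← mul_assoc, ← mul_assoc, ← ENNReal.ofReal_mul (by positivity),
      ← ENNReal.ofReal_mul (by positivity)]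
    congr 2
    rw [← add_assoc, Nat.factorial_succ]
    push_cast
    field_simp
    ring

theorem exists_unitary_rot (m : ℕ) (b : Fin (m + 1) → ℂ) :
    ∃ U : Matrix (Fin (m + 1)) (Fin (m + 1)) ℂ, Uᴴ * U = 1 ∧
      ∀ w : Fin (m + 1) → ℂ,
        ‖star b ⬝ᵥ (U *ᵥ w)‖ ^ 2 = (∑ i, ‖b i‖ ^ 2) * ‖w 0‖ ^ 2 := by
  by_cases hb : b = 0
  · exact ⟨1, by simp, by simp [hb]⟩
  set x : EuclideanSpace ℂ (Fin (m + 1)) := WithLp.toLp 2 b with hx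
  have hx0 : x ≠ 0 := by
    intro h
    apply hb
    ext i
    have := congrArg (fun y : EuclideanSpace ℂ (Fin (m + 1)) => y i) h
    simpa [hx] using this
  have hxn : ‖x‖ ≠ 0 := norm_ne_zero_iff.2 hx0
  obtain ⟨B, hB⟩ := Orthonormal.exists_orthonormalBasis_extension_of_card_eq
    (𝕜 := ℂ) (E := EuclideanSpace ℂ (Fin (m + 1))) (ι := Fin (m + 1)) (by simp)
    (v := fun _ => ((‖x‖⁻¹ : ℝ) : ℂ) • x) (s := {0}) (by
      rw [orthonormal_iff_ite]
      rintro ⟨i, rfl⟩ ⟨j, rfl⟩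
      have hn1 : ‖((‖x‖⁻¹ : ℝ) : ℂ) • x‖ = 1 := by
        rw [norm_smul, Complex.norm_real, norm_inv, norm_norm, inv_mul_cancel₀ hxn]
      simp only [Set.domRestrict_apply, inner_self_eq_norm_sq_to_K, hn1]
      simp)
  have hB0 := hB 0 rfl
  have hxB : x = (‖x‖ : ℂ) • B 0 := by
    rw [hB0, smul_smul, ← Complex.ofReal_mul, mul_inv_cancel₀ hxn]
    simp
  have hin : ∀ j, ∑ i, star (b i) * B j i = (‖x‖ : ℂ) * (if 0 = j then 1 else 0) := by
    intro j
    have h1 : inner ℂ x (B j) = ∑ i, star (b i) * B j i := by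
      simp [PiLp.inner_apply, hx, mul_comm]
    rw [← h1, hxB, inner_smul_left, orthonormal_iff_ite.1 B.orthonormal, ← hxB]
    simp
  refine ⟨Matrix.of fun i j => B j i, ?_, fun w => ?_⟩
  · ext i j
    have := orthonormal_iff_ite.1 B.orthonormal i j
    rw [Matrix.one_apply, ← this]
    simp [Matrix.mul_apply, PiLp.inner_apply, mul_comm]
  · have : star b ⬝ᵥ ((Matrix.of fun i j => B j i) *ᵥ w) = (‖x‖ : ℂ) * w 0 := by
      rw [dotProduct_mulVec]
      simp only [dotProduct, vecMul, Pi.star_apply, Matrix.of_apply, hin]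
      simp
    rw [this, norm_mul, mul_pow]
    congr 1
    rw [Complex.norm_real, norm_norm, EuclideanSpace.norm_sq_eq]

theorem lintegral_mulVec (n : ℕ) (M : Matrix (Fin n) (Fin n) ℂ) (hM : M.det ≠ 0)
    (F : (Fin n → ℂ) → ENNReal) (hF : Measurable F) :
    ∫⁻ u, F u = ENNReal.ofReal (‖M.det‖ ^ 2) * ∫⁻ w, F (M *ᵥ w) := by
  have hd : LinearMap.det ((Matrix.toLin' M).restrictScalars ℝ) = ‖M.det‖ ^ 2 := by
    rw [LinearMap.det_restrictScalars, LinearMap.det_toLin', Algebra.norm_complex_apply,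
      Complex.normSq_eq_norm_sq]
  have hpos : 0 < ‖M.det‖ ^ 2 := by positivity
  have h := Measure.map_linearMap_addHaar_eq_smul_addHaar (volume : Measure (Fin n → ℂ))
    (f := (Matrix.toLin' M).restrictScalars ℝ) (by rw [hd]; exact hpos.ne')
  have hm : Measurable ((Matrix.toLin' M).restrictScalars ℝ) :=
    (LinearMap.continuous_of_finiteDimensional _).measurable
  have h2 := lintegral_map (μ := volume) hF hm
  rw [h, hd, lintegral_smul_measure] at h2
  simp only [LinearMap.coe_restrictScalars, Matrix.toLin'_apply] at h2
  rw [← h2, smul_eq_mul, ← mul_assoc, ← ENNReal.ofReal_mul hpos.le, abs_of_pos (by positivity),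
    mul_inv_cancel₀ hpos.ne']
  simp

/-- If `u` has density proportional to `(1 - u* S⁻² u)^p` on `E_S = {u : u* S⁻² u ≤ 1}`,
then `|a* u|²` is distributed as `‖Sa‖² Y_{p+n+1}` where `Y_m` has density
`(m-1)(1-y)^{m-2}` on `(0,1)`: stated as an identity of integrals of an arbitrary
nonnegative measurable test function. -/
theorem lintegral_inner_sq_one_sub_quadForm_pow
    (n p : ℕ) (hn : 1 ≤ n)
    (S : Matrix (Fin n) (Fin n) ℂ) (hS : S.PosDef) (a : Fin n → ℂ)
    (f : ℝ → ENNReal) (hf : Measurable f) :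
    ∫⁻ u in {u : Fin n → ℂ | (star u ⬝ᵥ ((S ^ 2)⁻¹ *ᵥ u)).re ≤ 1},
        f (‖star a ⬝ᵥ u‖ ^ 2)
          * ENNReal.ofReal ((1 - (star u ⬝ᵥ ((S ^ 2)⁻¹ *ᵥ u)).re) ^ p)
      = ENNReal.ofReal
          ((π ^ n * (Nat.factorial p : ℝ) / (Nat.factorial (p + n) : ℝ)) * ‖S.det‖ ^ 2)
        * ∫⁻ y in Ioo (0 : ℝ) 1,
            f ((∑ i, ‖(S *ᵥ a) i‖ ^ 2) * y)
              * ENNReal.ofReal (((p : ℝ) + n) * (1 - y) ^ (p + n - 1)) := by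
  obtain ⟨m, rfl⟩ : ∃ m, n = m + 1 := ⟨n - 1, by omega⟩
  have hSd : S.det ≠ 0 := hS.det_pos.ne'
  have hSh : Sᴴ = S := hS.isHermitian
  obtain ⟨U, hU, hrot⟩ := exists_unitary_rot m (S *ᵥ a)
  have hUd : ‖U.det‖ = 1 := by
    have := congrArg Matrix.det hU
    rw [det_mul, det_conjTranspose, det_one] at this
    have h2 := congrArg norm this
    rw [norm_mul, norm_star, norm_one] at h2
    nlinarith [norm_nonneg U.det]
  have hUd0 : U.det ≠ 0 := by
    intro h
    simp [h] at hUd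
  have hq : ∀ w : Fin (m + 1) → ℂ,
      (star ((S * U) *ᵥ w) ⬝ᵥ ((S ^ 2)⁻¹ *ᵥ ((S * U) *ᵥ w))).re = ∑ i, ‖w i‖ ^ 2 := by
    intro w
    have hS1 : IsUnit S.det := isUnit_iff_ne_zero.2 hSd
    have hM : (S * U)ᴴ * ((S ^ 2)⁻¹ * (S * U)) = 1 := by
      rw [conjTranspose_mul, hSh, sq, Matrix.mul_inv_rev]
      calc Uᴴ * S * (S⁻¹ * S⁻¹ * (S * U)) = Uᴴ * (S * S⁻¹) * (S⁻¹ * S) * U := by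
            simp only [Matrix.mul_assoc]
        _ = 1 := by rw [mul_nonsing_inv _ hS1, nonsing_inv_mul _ hS1]; simpa using hU
    rw [mulVec_mulVec, star_mulVec, ← dotProduct_mulVec, mulVec_mulVec, hM, one_mulVec]
    simp [dotProduct, Complex.normSq_eq_norm_sq, ← Complex.normSq_eq_conj_mul_self,
      ← Complex.ofReal_pow]
  have ha : ∀ w : Fin (m + 1) → ℂ,
      ‖star a ⬝ᵥ ((S * U) *ᵥ w)‖ ^ 2 = (∑ i, ‖(S *ᵥ a) i‖ ^ 2) * ‖w 0‖ ^ 2 := by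
    intro w
    rw [← hrot w, star_mulVec, hSh, ← mulVec_mulVec, ← dotProduct_mulVec]
  have hms := measurable_truncPow p
  have hset : MeasurableSet {u : Fin (m + 1) → ℂ | (star u ⬝ᵥ ((S ^ 2)⁻¹ *ᵥ u)).re ≤ 1} := by
    apply IsClosed.measurableSet
    exact isClosed_le (by fun_prop) (by fun_prop)
  have hQ : Measurable fun u : Fin (m + 1) → ℂ => (star u ⬝ᵥ ((S ^ 2)⁻¹ *ᵥ u)).re :=
    Continuous.measurable (by fun_prop)
  have hA : Measurable fun u : Fin (m + 1) → ℂ => ‖star a ⬝ᵥ u‖ ^ 2 :=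
    Continuous.measurable (by fun_prop)
  rw [← lintegral_indicator hset]
  have e1 : ∀ u : Fin (m + 1) → ℂ,
      ({u : Fin (m + 1) → ℂ | (star u ⬝ᵥ ((S ^ 2)⁻¹ *ᵥ u)).re ≤ 1}).indicator
        (fun u => f (‖star a ⬝ᵥ u‖ ^ 2)
          * ENNReal.ofReal ((1 - (star u ⬝ᵥ ((S ^ 2)⁻¹ *ᵥ u)).re) ^ p)) u
      = f (‖star a ⬝ᵥ u‖ ^ 2) * truncPow p (1 - (star u ⬝ᵥ ((S ^ 2)⁻¹ *ᵥ u)).re) := by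
    intro u
    simp only [indicator, truncPow, mem_ofPred_eq, mem_Ici, sub_nonneg]
    split_ifs <;> simp
  simp_rw [e1]
  rw [lintegral_mulVec _ (S * U) (by rw [det_mul]; exact mul_ne_zero hSd hUd0) _
    (by fun_prop)]
  simp_rw [hq, ha]
  set c := ∑ i, ‖(S *ᵥ a) i‖ ^ 2 with hc
  simp_rw [Fin.sum_univ_succ, ← sub_sub]
  rw [lintegral_fin_succ m (fun z v => f (c * ‖z‖ ^ 2)
      * truncPow p (1 - ‖z‖ ^ 2 - ∑ i, ‖v i‖ ^ 2))
      (by simp only [Function.uncurry_def]; fun_prop)]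
  have e2 : ∀ z : ℂ, ∫⁻ v : Fin m → ℂ, f (c * ‖z‖ ^ 2)
        * truncPow p (1 - ‖z‖ ^ 2 - ∑ i, ‖v i‖ ^ 2)
      = ENNReal.ofReal (π ^ m * (Nat.factorial p : ℝ) / (Nat.factorial (p + m) : ℝ))
        * (f (c * ‖z‖ ^ 2) * truncPow (p + m) (1 - ‖z‖ ^ 2)) := by
    intro z
    rw [lintegral_const_mul _ (by fun_prop), lintegral_truncPow_pi]
    ring
  simp_rw [e2]
  have hms2 := measurable_truncPow (p + m)
  rw [lintegral_const_mul _ (by fun_prop),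
    lintegral_complex_normSq (fun y => f (c * y) * truncPow (p + m) (1 - y)) (by fun_prop)]
  have e3 : ∫⁻ y in Ioi (0 : ℝ), f (c * y) * truncPow (p + m) (1 - y)
      = ∫⁻ y in Ioo (0 : ℝ) 1, f (c * y) * ENNReal.ofReal ((1 - y) ^ (p + m)) := by
    have : ∀ y, f (c * y) * truncPow (p + m) (1 - y)
        = (Iic (1 : ℝ)).indicator (fun y => f (c * y) * ENNReal.ofReal ((1 - y) ^ (p + m))) y := by
      intro y
      simp only [indicator, truncPow, mem_Iic, mem_Ici, sub_nonneg]
      split_ifs <;> simp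
    simp_rw [this]
    rw [lintegral_indicator measurableSet_Iic, Measure.restrict_restrict measurableSet_Iic,
      Iic_inter_Ioi]
    exact setLIntegral_congr Ioo_ae_eq_Ioc.symm
  have e4 : ∫⁻ y in Ioo (0 : ℝ) 1, f (c * y)
        * ENNReal.ofReal (((p : ℝ) + (m + 1 : ℕ)) * (1 - y) ^ (p + (m + 1) - 1))
      = ENNReal.ofReal ((p : ℝ) + (m + 1 : ℕ))
        * ∫⁻ y in Ioo (0 : ℝ) 1, f (c * y) * ENNReal.ofReal ((1 - y) ^ (p + m)) := by
    rw [← lintegral_const_mul _ (by fun_prop)]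
    refine lintegral_congr fun y => ?_
    rw [ENNReal.ofReal_mul (by positivity), ← add_assoc, Nat.add_sub_cancel]
    ring
  rw [e3, e4, ← mul_assoc, ← mul_assoc, ← mul_assoc, ← ENNReal.ofReal_mul (by positivity),
    ← ENNReal.ofReal_mul (by positivity), ← ENNReal.ofReal_mul (by positivity)]
  congr 2
  rw [det_mul, norm_mul, hUd, ← add_assoc, Nat.factorial_succ]
  push_cast
  have : (p : ℝ) + m + 1 ≠ 0 := by positivity
  field_simp
  ring
end
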